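/- arXiv:math/0612695 — 5 statements merged into one kernel-verified Lean document; each statement's English description precedes it below -/
import Mathlib

section
/- Let α be an irrational real number and λ > 0. For h > 0, define N_h(λ) to be the number of pairs of integers (k,l) ∈ ℤ² such that (4π²/(1+α²))·((k+αl)² + h²·(l−αk)²) < λ. Then h·N_h(λ) → λ/(4π) as h → 0⁺; equivalently, N_h(λ) = (1/(4π))·h⁻¹·λ + o(h⁻¹) as h → 0⁺. -/
open Filter

/-- Volume of a union of unit squares is the number of the squares. -/
lemma volume_floor_preimage (S : Set (ℤ × ℤ)) :
    MeasureTheory.volume ((fun z : ℂ => ((⌊z.re⌋, ⌊z.im⌋) : ℤ × ℤ)) ⁻¹' S) = S.encard := by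
  have hsq : ∀ b : ℤ × ℤ, (fun z : ℂ => ((⌊z.re⌋, ⌊z.im⌋) : ℤ × ℤ)) ⁻¹' {b}
      = Complex.measurableEquivRealProd ⁻¹'
        (Set.Ico (b.1 : ℝ) (b.1 + 1) ×ˢ Set.Ico (b.2 : ℝ) (b.2 + 1)) := by
    rintro ⟨m, n⟩
    ext z
    simp [Complex.measurableEquivRealProd_apply, Int.floor_eq_iff, and_assoc]
  have hm : ∀ b : ℤ × ℤ, MeasurableSet
      ((Set.Ico (b.1 : ℝ) (b.1 + 1) ×ˢ Set.Ico (b.2 : ℝ) (b.2 + 1))) :=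
    fun b => measurableSet_Ico.prod measurableSet_Ico
  rw [← MeasureTheory.tsum_measure_preimage_singleton (Set.to_countable S)]
  · rw [← ENNReal.tsum_set_one]
    congr 1
    ext b
    rw [hsq, Complex.volume_preserving_equiv_real_prod.measure_preimage (hm _).nullMeasurableSet,
      MeasureTheory.Measure.volume_eq_prod, MeasureTheory.Measure.prod_prod]
    simp
  · intro b _
    rw [hsq]
    exact Complex.measurableEquivRealProd.measurable (hm b)

/-- Counting the points of a planar lattice in a disc. -/
lemma lattice_count (w1 w2 : ℂ) (R δ D : ℝ) (hδ : ‖w1‖ + ‖w2‖ ≤ δ) (hR : δ ≤ R)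
    (hD : D = |w1.re * w2.im - w2.re * w1.im|) (hD0 : 0 < D) :
    Real.pi * (R - δ) ^ 2 ≤ D * (Nat.card {p : ℤ × ℤ | ‖(p.1 : ℂ) * w1 + (p.2 : ℂ) * w2‖ < R} : ℝ) ∧
    D * (Nat.card {p : ℤ × ℤ | ‖(p.1 : ℂ) * w1 + (p.2 : ℂ) * w2‖ < R} : ℝ)
      ≤ Real.pi * (R + δ) ^ 2 := by
  set S : Set (ℤ × ℤ) := {p : ℤ × ℤ | ‖(p.1 : ℂ) * w1 + (p.2 : ℂ) * w2‖ < R} with hS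
  have hδ0 : 0 ≤ δ := by linarith [norm_nonneg w1, norm_nonneg w2]
  let M : Matrix (Fin 2) (Fin 2) ℝ := !![w1.re, w2.re; w1.im, w2.im]
  let T : ℂ →ₗ[ℝ] ℂ := Matrix.toLin Complex.basisOneI Complex.basisOneI M
  have hT : ∀ z : ℂ, T z = (z.re : ℂ) * w1 + (z.im : ℂ) * w2 := by
    intro z
    simp only [T, M, Matrix.toLin_apply]
    apply Complex.ext <;>
      simp [Fin.sum_univ_two, Matrix.mulVec, dotProduct] <;> ring
  have hdet : LinearMap.det T = w1.re * w2.im - w2.re * w1.im := by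
    simp only [T, LinearMap.det_toLin, M, Matrix.det_fin_two_of]
  have hne : LinearMap.det T ≠ 0 := by
    rw [hdet]; intro h0; rw [hD, h0] at hD0; simp at hD0
  have hvol : ∀ r : ℝ, 0 ≤ r → MeasureTheory.volume (T ⁻¹' Metric.ball 0 r)
      = ENNReal.ofReal (Real.pi * r ^ 2 / D) := by
    intro r hr
    rw [MeasureTheory.Measure.addHaar_preimage_linearMap _ hne, Complex.volume_ball, hdet, abs_inv,
      ← hD, ← ENNReal.ofReal_pow hr]
    rw [show ((NNReal.pi : NNReal) : ENNReal) = ENNReal.ofReal Real.pi by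
      rw [← NNReal.coe_real_pi, ENNReal.ofReal_coe_nnreal]]
    rw [← ENNReal.ofReal_mul (by positivity), ← ENNReal.ofReal_mul (by positivity)]
    congr 1
    field_simp
  have hclose : ∀ z : ℂ, ‖T z - (((⌊z.re⌋ : ℤ) : ℂ) * w1 + ((⌊z.im⌋ : ℤ) : ℂ) * w2)‖ ≤ δ := by
    intro z
    have : T z - (((⌊z.re⌋ : ℤ) : ℂ) * w1 + ((⌊z.im⌋ : ℤ) : ℂ) * w2)
        = ((Int.fract z.re : ℝ) : ℂ) * w1 + ((Int.fract z.im : ℝ) : ℂ) * w2 := by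
      rw [hT, Int.fract, Int.fract]; push_cast; ring
    rw [this]
    refine (norm_add_le _ _).trans (le_trans ?_ hδ)
    rw [norm_mul, norm_mul, Complex.norm_real, Complex.norm_real, Real.norm_eq_abs,
      Real.norm_eq_abs, Int.abs_fract, Int.abs_fract]
    have h1 := (Int.fract_lt_one z.re).le
    have h2 := (Int.fract_lt_one z.im).le
    exact add_le_add (mul_le_of_le_one_left (norm_nonneg _) h1)
      (mul_le_of_le_one_left (norm_nonneg _) h2)
  have hup : (S.encard : ENNReal) ≤ ENNReal.ofReal (Real.pi * (R + δ) ^ 2 / D) := by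
    rw [← volume_floor_preimage, ← hvol _ (by linarith)]
    apply MeasureTheory.measure_mono
    intro z hz
    have hz' : ‖((⌊z.re⌋ : ℤ) : ℂ) * w1 + ((⌊z.im⌋ : ℤ) : ℂ) * w2‖ < R := hz
    have h1 := hclose z
    have h2 := norm_le_norm_add_norm_sub' (T z)
      (((⌊z.re⌋ : ℤ) : ℂ) * w1 + ((⌊z.im⌋ : ℤ) : ℂ) * w2)
    simp only [Set.mem_preimage, mem_ball_zero_iff]
    linarith
  have hlo : ENNReal.ofReal (Real.pi * (R - δ) ^ 2 / D) ≤ (S.encard : ENNReal) := by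
    rw [← volume_floor_preimage, ← hvol _ (by linarith)]
    apply MeasureTheory.measure_mono
    intro z hz
    simp only [Set.mem_preimage, mem_ball_zero_iff] at hz
    have h1 := hclose z
    have h2 := norm_le_norm_add_norm_sub (T z)
      (((⌊z.re⌋ : ℤ) : ℂ) * w1 + ((⌊z.im⌋ : ℤ) : ℂ) * w2)
    change ‖((⌊z.re⌋ : ℤ) : ℂ) * w1 + ((⌊z.im⌋ : ℤ) : ℂ) * w2‖ < R
    linarith
  have hfin : S.Finite := by
    rw [← Set.encard_ne_top_iff]
    intro h
    rw [h] at hup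
    simp at hup
  have hcard : (S.encard : ENNReal) = ENNReal.ofReal (Nat.card S : ℝ) := by
    rw [← hfin.cast_ncard_eq, ENNReal.ofReal_natCast]
    rfl
  rw [hcard] at hup hlo
  rw [ENNReal.ofReal_le_ofReal_iff (by positivity)] at hup hlo
  rw [div_le_iff₀ hD0] at hlo
  rw [le_div_iff₀ hD0] at hup
  constructor <;> linarith

/-- There is a unimodular basis of `ℤ²` on which `k + α l` is small. -/
lemma exists_basis (α : ℝ) (hα : Irrational α) (ε : ℝ) (hε : 0 < ε) :
    ∃ k1 l1 k2 l2 : ℤ, k1 * l2 - k2 * l1 = 1 ∧ |(k1 : ℝ) + α * l1| < ε ∧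
      |(k2 : ℝ) + α * l2| < ε := by
  obtain ⟨n, hn⟩ := exists_nat_one_div_lt hε
  obtain ⟨q, hq, -⟩ := Real.exists_rat_abs_sub_le_and_den_le α (Nat.succ_pos n)
  have hd : (0 : ℝ) < q.den := by exact_mod_cast q.den_pos
  have hcast : (q : ℝ) = q.num / q.den := by exact_mod_cast (Rat.cast_def (K := ℝ) q)
  set x : ℝ := -(q.num : ℝ) + α * q.den with hx
  have hx1 : |x| < ε := by
    have : x = (α - q) * q.den := by rw [hcast]; field_simp; ring
    rw [this, abs_mul, abs_of_pos hd]
    refine lt_of_le_of_lt (mul_le_mul_of_nonneg_right hq hd.le) (lt_of_le_of_lt ?_ hn)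
    rw [div_mul_eq_mul_div, one_mul, div_le_div_iff₀ (by positivity) (by positivity)]
    push_cast
    nlinarith
  have hx0 : x ≠ 0 := by
    intro h
    apply hα
    refine ⟨q, ?_⟩
    rw [hcast, div_eq_iff hd.ne']
    linarith
  have hcop : IsCoprime (-q.num) (q.den : ℤ) := by
    rw [IsCoprime.neg_left_iff]
    exact q.isCoprime_num_den
  obtain ⟨a, b, hab⟩ := hcop
  set y : ℝ := -(b : ℝ) + α * a with hy
  set t : ℤ := ⌊y / x⌋ with ht
  refine ⟨-q.num, q.den, -b - t * (-q.num), a - t * q.den, by linear_combination hab, ?_, ?_⟩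
  · push_cast; exact hx1
  · have : ((-b - t * (-q.num) : ℤ) : ℝ) + α * ((a - t * q.den : ℤ) : ℝ)
        = Int.fract (y / x) * x := by
      rw [Int.fract, ← ht, sub_mul, div_mul_cancel₀ _ hx0, hx, hy]; push_cast; ring
    rw [this, abs_mul, Int.abs_fract]
    exact (mul_le_of_le_one_left (abs_nonneg _) (Int.fract_lt_one _).le).trans_lt hx1

/-- Irrational case: the eigenvalue distribution function
`N_h(λ) = #{(k,l) ∈ ℤ² : (4π²/(1+α²))((k+αl)² + h²(l−αk)²) < λ}`
satisfies `h·N_h(λ) → λ/(4π)` as `h → 0⁺`. -/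
theorem kronecker_adiabatic_irrational (α : ℝ) (hα : Irrational α)
    (lam : ℝ) (hlam : 0 < lam) (N : ℝ → ℕ)
    (hN : ∀ h : ℝ, N h = Nat.card {kl : ℤ × ℤ |
      (4 * Real.pi ^ 2 / (1 + α ^ 2)) *
        (((kl.1 : ℝ) + α * (kl.2 : ℝ)) ^ 2
          + h ^ 2 * ((kl.2 : ℝ) - α * (kl.1 : ℝ)) ^ 2) < lam}) :
    Tendsto (fun h : ℝ => h * (N h : ℝ)) (nhdsWithin 0 (Set.Ioi 0))
      (nhds (lam / (4 * Real.pi))) := by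
  have hA : 0 < 1 + α ^ 2 := by positivity
  have hpi := Real.pi_pos
  obtain ⟨R, hR0, hR2⟩ : ∃ R : ℝ, 0 < R ∧ R ^ 2 = lam * (1 + α ^ 2) / (4 * Real.pi ^ 2) :=
    ⟨√(lam * (1 + α ^ 2) / (4 * Real.pi ^ 2)), Real.sqrt_pos.2 (by positivity),
      Real.sq_sqrt (by positivity)⟩
  have hlim : lam / (4 * Real.pi) = Real.pi * R ^ 2 / (1 + α ^ 2) := by
    rw [hR2]; field_simp
  rw [hlim, Metric.tendsto_nhds]
  intro ε hε
  have hcont : ContinuousAt (fun x : ℝ => Real.pi * x ^ 2 / (1 + α ^ 2)) R := by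
    fun_prop (disch := positivity)
  obtain ⟨δ0, hδ0, hcl⟩ := Metric.continuousAt_iff.1 hcont ε hε
  obtain ⟨δ, hδ, hδ1, hδR⟩ : ∃ δ : ℝ, 0 < δ ∧ δ < δ0 ∧ δ ≤ R :=
    ⟨min (δ0 / 2) R, by positivity, (min_le_left _ _).trans_lt (by linarith), min_le_right _ _⟩
  obtain ⟨k1, l1, k2, l2, hdet, hb1, hb2⟩ := exists_basis α hα (δ / 4) (by positivity)
  set C : ℝ := |(l1 : ℝ) - α * k1| + |(l2 : ℝ) - α * k2| + 1 with hC
  have hC0 : 0 < C := by positivity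
  have hev : ∀ᶠ h in nhdsWithin (0 : ℝ) (Set.Ioi 0), h ∈ Set.Ioo 0 (δ / (2 * C)) :=
    Ioo_mem_nhdsGT (by positivity)
  filter_upwards [hev] with h hh
  obtain ⟨hh0, hh1⟩ := hh
  rw [lt_div_iff₀ (by positivity)] at hh1
  let w1 : ℂ := ⟨(k1 : ℝ) + α * l1, h * ((l1 : ℝ) - α * k1)⟩
  let w2 : ℂ := ⟨(k2 : ℝ) + α * l2, h * ((l2 : ℝ) - α * k2)⟩
  have hw : ‖w1‖ + ‖w2‖ ≤ δ := by
    have e1 := Complex.norm_le_abs_re_add_abs_im w1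
    have e2 := Complex.norm_le_abs_re_add_abs_im w2
    simp only [w1, w2, abs_mul, abs_of_pos hh0] at e1 e2
    have : h * |(l1 : ℝ) - α * k1| + h * |(l2 : ℝ) - α * k2| ≤ δ / 2 := by
      rw [hC] at hh1; linarith
    linarith
  have hdetR : (k1 : ℝ) * l2 - k2 * l1 = 1 := by exact_mod_cast hdet
  have hD : h * (1 + α ^ 2) = |w1.re * w2.im - w2.re * w1.im| := by
    have : w1.re * w2.im - w2.re * w1.im = h * (1 + α ^ 2) := by
      simp only [w1, w2]
      linear_combination (h * (1 + α ^ 2)) * hdetR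
    rw [this, abs_of_pos (by positivity)]
  have key := lattice_count w1 w2 R δ _ hw hδR hD (by positivity)
  have hcard : N h = Nat.card {p : ℤ × ℤ | ‖(p.1 : ℂ) * w1 + (p.2 : ℂ) * w2‖ < R} := by
    rw [hN]
    let e : ℤ × ℤ ≃ ℤ × ℤ :=
      { toFun := fun p => (p.1 * k1 + p.2 * k2, p.1 * l1 + p.2 * l2)
        invFun := fun p => (p.1 * l2 - p.2 * k2, p.2 * k1 - p.1 * l1)
        left_inv := by
          rintro ⟨m, n⟩
          ext
          · simp only; linear_combination m * hdet
          · simp only; linear_combination n * hdet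
        right_inv := by
          rintro ⟨m, n⟩
          ext
          · simp only; linear_combination m * hdet
          · simp only; linear_combination n * hdet }
    symm
    refine Nat.card_congr (e.subtypeEquiv ?_)
    rintro ⟨m, n⟩
    simp only [Set.mem_setOf_eq, e, Equiv.coe_fn_mk]
    rw [← sq_lt_sq₀ (norm_nonneg _) hR0.le, Complex.sq_norm, Complex.normSq_apply, hR2,
      lt_div_iff₀ (by positivity), div_mul_eq_mul_div, div_lt_iff₀ hA]
    simp only [w1, w2, Complex.add_re, Complex.add_im, Complex.mul_re, Complex.mul_im,
      Complex.intCast_re, Complex.intCast_im]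
    push_cast
    ring_nf
  rw [← hcard] at key
  obtain ⟨klo, kup⟩ := key
  have c1 := hcl (x := R - δ) (by simpa [Real.dist_eq, abs_of_pos hδ] using hδ1)
  have c2 := hcl (x := R + δ) (by simpa [Real.dist_eq, abs_of_pos hδ] using hδ1)
  rw [Real.dist_eq, abs_lt] at c1 c2 ⊢
  have d1 : Real.pi * (R - δ) ^ 2 / (1 + α ^ 2) ≤ h * N h := by
    rw [div_le_iff₀ hA]; linarith
  have d2 : h * N h ≤ Real.pi * (R + δ) ^ 2 / (1 + α ^ 2) := by
    rw [le_div_iff₀ hA]; linarith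
  constructor <;> linarith [c1.1, c2.2]
end

section
/- Let p, q be coprime integers with q ≠ 0, let α = p/q, and let λ > 0. For h > 0, define N_h(λ) to be the number of pairs of integers (k,l) ∈ ℤ² such that (4π²/(1+α²))·((k+αl)² + h²·(l−αk)²) < λ. Then h·N_h(λ) → (1/(π·√(p²+q²)))·Σ_{k ∈ ℤ, 4π²k²/(p²+q²) < λ} (λ − 4π²k²/(p²+q²))^{1/2} as h → 0⁺; equivalently, N_h(λ) = h⁻¹·(1/(π·√(p²+q²)))·Σ_{k ∈ ℤ, 4π²k²/(p²+q²) < λ} (λ − 4π²k²/(p²+q²))^{1/2} + o(h⁻¹) as h → 0⁺. -/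
open Filter

lemma aux_count (D c R : ℝ) (hD : 0 < D) (hR : 0 < R) :
    |(((Finset.Ioo ⌊(-R - c) / D⌋ ⌈(R - c) / D⌉).card : ℕ) : ℝ) - 2 * R / D| ≤ 2 := by
  rw [Int.card_Ioo]
  have hab : (-R - c) / D < (R - c) / D := by gcongr; linarith
  have h1 := Int.floor_le ((-R - c) / D)
  have h2 := Int.lt_floor_add_one ((-R - c) / D)
  have h3 := Int.le_ceil ((R - c) / D)
  have h4 := Int.ceil_lt_add_one ((R - c) / D)
  have h5 : ⌊(-R - c) / D⌋ < ⌈(R - c) / D⌉ := by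
    have : (⌊(-R - c) / D⌋ : ℝ) < ⌈(R - c) / D⌉ := by linarith
    exact_mod_cast this
  have h6 : (((⌈(R - c) / D⌉ - ⌊(-R - c) / D⌋ - 1).toNat : ℕ) : ℝ)
      = (⌈(R - c) / D⌉ : ℝ) - ⌊(-R - c) / D⌋ - 1 := by
    have : (((⌈(R - c) / D⌉ - ⌊(-R - c) / D⌋ - 1).toNat : ℕ) : ℤ)
      = ⌈(R - c) / D⌉ - ⌊(-R - c) / D⌋ - 1 := Int.toNat_of_nonneg (by omega)
    exact_mod_cast this
  rw [h6]
  have h7 : 2 * R / D = (R - c) / D - (-R - c) / D := by field_simp; ring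
  rw [h7, abs_le]
  constructor <;> linarith

lemma aux_mem (D c R : ℝ) (hD : 0 < D) (t : ℤ) :
    t ∈ Finset.Ioo ⌊(-R - c) / D⌋ ⌈(R - c) / D⌉ ↔ |D * t + c| < R := by
  rw [Finset.mem_Ioo, Int.floor_lt, Int.lt_ceil, div_lt_iff₀ hD, lt_div_iff₀ hD, abs_lt]
  constructor <;> rintro ⟨h1, h2⟩ <;> constructor <;> linarith

lemma aux_cond (D E x h m lam : ℝ) (hD : 0 < D) (hh : 0 < h)
    (hE : E = lam - 4 * Real.pi ^ 2 * m ^ 2 / D) :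
    4 * Real.pi ^ 2 / D * (m ^ 2 + h ^ 2 * x ^ 2) < lam ↔
      0 < E ∧ |x| < √E * √D / (2 * Real.pi) / h := by
  have hpi := Real.pi_pos
  have e1 : 4 * Real.pi ^ 2 / D * (m ^ 2 + h ^ 2 * x ^ 2) < lam ↔
      4 * Real.pi ^ 2 / D * (h ^ 2 * x ^ 2) < E := by
    rw [hE, lt_sub_iff_add_lt]
    have : 4 * Real.pi ^ 2 / D * (m ^ 2 + h ^ 2 * x ^ 2) =
      4 * Real.pi ^ 2 / D * (h ^ 2 * x ^ 2) + 4 * Real.pi ^ 2 * m ^ 2 / D := by ring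
    rw [this]
  rw [e1]
  have key : 0 < E → (4 * Real.pi ^ 2 / D * (h ^ 2 * x ^ 2) < E ↔
      |x| < √E * √D / (2 * Real.pi) / h) := by
    intro hE0
    rw [← abs_of_nonneg (show 0 ≤ √E * √D / (2 * Real.pi) / h by positivity), ← sq_lt_sq]
    rw [div_pow, div_pow, mul_pow, Real.sq_sqrt hE0.le, Real.sq_sqrt hD.le, div_div,
      lt_div_iff₀ (by positivity), div_mul_eq_mul_div, div_lt_iff₀ hD]
    constructor <;> intro h <;> linarith
  constructor
  · intro hx
    have h0 : 0 < E := lt_of_le_of_lt (by positivity) hx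
    exact ⟨h0, (key h0).1 hx⟩
  · rintro ⟨h0, hx⟩
    exact (key h0).2 hx

lemma aux_fin (D lam : ℝ) (hD : 0 < D) :
    {k : ℤ | 4 * Real.pi ^ 2 * (k : ℝ) ^ 2 / D < lam}.Finite := by
  have hpi := Real.pi_pos
  obtain ⟨n, hn⟩ := exists_nat_gt (lam * D / (4 * Real.pi ^ 2))
  refine (Set.finite_Icc (-(n : ℤ)) n).subset ?_
  intro k hk
  simp only [Set.mem_ofPred_eq] at hk
  rw [div_lt_iff₀ hD] at hk
  rw [div_lt_iff₀ (by positivity)] at hn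
  have h1 : (k : ℝ) ^ 2 < n := by
    have : 4 * Real.pi ^ 2 * (k : ℝ) ^ 2 < 4 * Real.pi ^ 2 * n := by linarith
    exact lt_of_mul_lt_mul_left this (by positivity)
  have h2 : k ^ 2 < (n : ℤ) := by exact_mod_cast h1
  rw [Set.mem_Icc]
  constructor <;> nlinarith [sq_nonneg (k - 1), sq_nonneg (k + 1), sq_nonneg k]

/-- Rational case `α = p/q` with `p, q` coprime: the eigenvalue distribution function
`N_h(λ) = #{(k,l) ∈ ℤ² : (4π²/(1+α²))((k+αl)² + h²(l−αk)²) < λ}` satisfies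
`h·N_h(λ) → (1/(π√(p²+q²))) Σ_{k : 4π²k²/(p²+q²) < λ} (λ − 4π²k²/(p²+q²))^{1/2}`
as `h → 0⁺`. -/
theorem kronecker_adiabatic_rational (p q : ℤ) (hpq : IsCoprime p q) (hq : q ≠ 0)
    (α : ℝ) (hα : α = (p : ℝ) / (q : ℝ)) (lam : ℝ) (hlam : 0 < lam) (N : ℝ → ℕ)
    (hN : ∀ h : ℝ, N h = Nat.card {kl : ℤ × ℤ |
      (4 * Real.pi ^ 2 / (1 + α ^ 2)) *
        (((kl.1 : ℝ) + α * (kl.2 : ℝ)) ^ 2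
          + h ^ 2 * ((kl.2 : ℝ) - α * (kl.1 : ℝ)) ^ 2) < lam}) :
    Tendsto (fun h : ℝ => h * (N h : ℝ)) (nhdsWithin 0 (Set.Ioi 0))
      (nhds ((1 / (Real.pi * Real.sqrt ((p : ℝ) ^ 2 + (q : ℝ) ^ 2))) *
        ∑ᶠ k ∈ {k : ℤ |
            4 * Real.pi ^ 2 * (k : ℝ) ^ 2 / ((p : ℝ) ^ 2 + (q : ℝ) ^ 2) < lam},
          Real.sqrt (lam -
            4 * Real.pi ^ 2 * (k : ℝ) ^ 2 / ((p : ℝ) ^ 2 + (q : ℝ) ^ 2)))) := by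
  have hpi := Real.pi_pos
  have hqR : (q : ℝ) ≠ 0 := by exact_mod_cast hq
  obtain ⟨a, b, hab⟩ := hpq
  have habR : (a : ℝ) * p + b * q = 1 := by exact_mod_cast hab
  set D : ℝ := (p : ℝ) ^ 2 + (q : ℝ) ^ 2 with hDdef
  have hD : 0 < D := by positivity
  have hfin := aux_fin D lam hD
  rw [finsum_mem_eq_finite_toFinset_sum _ hfin]
  set S := hfin.toFinset with hS
  set R : ℤ → ℝ := fun m =>
    √(lam - 4 * Real.pi ^ 2 * (m : ℝ) ^ 2 / D) * √D / (2 * Real.pi) with hRdef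
  set c : ℤ → ℝ := fun m => (m : ℝ) * (q * a - p * b) with hc
  set T : ℝ → ℤ → Finset ℤ := fun h m =>
    Finset.Ioo ⌊(-(R m / h) - c m) / D⌋ ⌈((R m / h) - c m) / D⌉ with hT
  have hmemS : ∀ m : ℤ, m ∈ S ↔ 0 < lam - 4 * Real.pi ^ 2 * (m : ℝ) ^ 2 / D := by
    intro m
    simp [hS, sub_pos]
  have hcount : ∀ h : ℝ, 0 < h → N h = ∑ m ∈ S, (T h m).card := by
    intro h hh
    rw [hN h, ← Finset.card_sigma]
    set f : (Σ _ : ℤ, ℤ) → ℤ × ℤ := fun x => (b * x.1 - p * x.2, a * x.1 + q * x.2) with hf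
    have hset : {kl : ℤ × ℤ |
      (4 * Real.pi ^ 2 / (1 + α ^ 2)) *
        (((kl.1 : ℝ) + α * (kl.2 : ℝ)) ^ 2
          + h ^ 2 * ((kl.2 : ℝ) - α * (kl.1 : ℝ)) ^ 2) < lam}
        = f '' (↑(S.sigma (T h)) : Set (Σ _ : ℤ, ℤ)) := by
      have hP : ∀ m t : ℤ, f ⟨m, t⟩ ∈ {kl : ℤ × ℤ |
        (4 * Real.pi ^ 2 / (1 + α ^ 2)) *
        (((kl.1 : ℝ) + α * (kl.2 : ℝ)) ^ 2
          + h ^ 2 * ((kl.2 : ℝ) - α * (kl.1 : ℝ)) ^ 2) < lam} ↔ m ∈ S ∧ t ∈ T h m := by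
        intro m t
        rw [hmemS, hT, aux_mem _ _ _ hD]
        rw [← aux_cond D _ (D * t + c m) h m lam hD hh rfl]
        simp only [Set.mem_ofPred_eq, hf]
        have e1 : (((b * m - p * t : ℤ) : ℝ) + α * ((a * m + q * t : ℤ) : ℝ)) = m / q := by
          rw [hα]; push_cast; field_simp; linear_combination (m : ℝ) * habR
        have e2 : (((a * m + q * t : ℤ) : ℝ) - α * ((b * m - p * t : ℤ) : ℝ))
            = (D * t + c m) / q := by
          rw [hα, hDdef, hc]; push_cast; field_simp; ring
        have e3 : 1 + α ^ 2 = D / q ^ 2 := by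
          rw [hα, hDdef]; field_simp; ring
        rw [e1, e2, e3]
        have e4 : 4 * Real.pi ^ 2 / (D / (q : ℝ) ^ 2) *
            (((m : ℝ) / q) ^ 2 + h ^ 2 * ((D * t + c m) / q) ^ 2)
            = 4 * Real.pi ^ 2 / D * ((m : ℝ) ^ 2 + h ^ 2 * (D * t + c m) ^ 2) := by
          field_simp
        rw [e4]
      have hsurj : ∀ kl : ℤ × ℤ, f ⟨q * kl.1 + p * kl.2, b * kl.2 - a * kl.1⟩ = kl := by
        rintro ⟨k, l⟩
        simp only [hf]
        ext
        · linear_combination k * hab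
        · linear_combination l * hab
      ext kl
      constructor
      · intro hkl
        rw [← hsurj kl, hP] at hkl
        exact ⟨_, by simpa using hkl, hsurj kl⟩
      · rintro ⟨⟨m, t⟩, hx, rfl⟩
        rw [hP]
        simpa using hx
    have hinj : Function.Injective f := by
      rintro ⟨m, t⟩ ⟨m', t'⟩ hx
      simp only [hf, Prod.mk.injEq] at hx
      obtain ⟨h1, h2⟩ := hx
      have hm : m = m' := by
        linear_combination q * h1 + p * h2 - (m - m') * hab
      have ht : t = t' := by
        linear_combination b * h2 - a * h1 - (t - t') * hab
      rw [hm, ht]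
    rw [hset, Nat.card_image_of_injective hinj]
    exact (Nat.card_coe_set_eq _).trans (Set.ncard_coe_finset _)
  have hlim : Tendsto (fun h : ℝ => ∑ m ∈ S, h * ((T h m).card : ℝ))
      (nhdsWithin 0 (Set.Ioi 0)) (nhds (∑ m ∈ S, 2 * R m / D)) := by
    refine tendsto_finsetSum _ fun m hm => ?_
    rw [tendsto_iff_norm_sub_tendsto_zero]
    have hz : Tendsto (fun h : ℝ => 2 * h) (nhdsWithin 0 (Set.Ioi 0)) (nhds 0) := by
      have : Tendsto (fun h : ℝ => 2 * h) (nhds 0) (nhds (2 * 0)) :=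
        (continuous_const.mul continuous_id).tendsto 0
      rw [mul_zero] at this
      exact this.mono_left nhdsWithin_le_nhds
    refine squeeze_zero' (Eventually.of_forall fun _ => norm_nonneg _) ?_ hz
    filter_upwards [self_mem_nhdsWithin] with h hh
    have hh : 0 < h := hh
    have hRm : 0 < R m := by
      have := (hmemS m).1 hm
      simp only [hRdef]
      positivity
    have := aux_count D (c m) (R m / h) hD (by positivity)
    have e : h * ((T h m).card : ℝ) - 2 * R m / D
        = h * (((T h m).card : ℝ) - 2 * (R m / h) / D) := by
      field_simp
    rw [e, norm_mul, Real.norm_eq_abs, Real.norm_eq_abs, abs_of_pos hh, mul_comm 2 h]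
    exact mul_le_mul_of_nonneg_left this hh.le
  have hval : ∑ m ∈ S, 2 * R m / D = (1 / (Real.pi * √D)) *
      ∑ m ∈ S, √(lam - 4 * Real.pi ^ 2 * (m : ℝ) ^ 2 / D) := by
    rw [Finset.mul_sum]
    refine Finset.sum_congr rfl fun m _ => ?_
    have hs : 0 < √D := Real.sqrt_pos.2 hD
    have hsq : √D * √D = D := Real.mul_self_sqrt hD.le
    simp only [hRdef]
    rw [← sub_eq_zero]
    generalize √(lam - 4 * Real.pi ^ 2 * (m : ℝ) ^ 2 / D) = y
    rw [sub_eq_zero, div_eq_iff hD.ne', ← hsq]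
    rw [hsq]
    field_simp
    linear_combination y * hsq
  rw [← hval]
  refine hlim.congr' ?_
  filter_upwards [self_mem_nhdsWithin] with h hh
  rw [hcount h hh]
  push_cast
  rw [Finset.mul_sum]
end

section
/- Let α be an irrational real number and t > 0. Then lim_{h→0⁺} Σ_{(k,l) ∈ ℤ², (k,l) ≠ (0,0)} exp(−(k+αl)²/(4t(1+α²)) − (l−αk)²/(4th²(1+α²))) = 0. -/
open Filter

lemma aux_summable (c : ℝ) (hc : 0 < c) :
    Summable (fun n : ℤ => Real.exp (-((n : ℝ) ^ 2 / c))) := by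
  have hp := Real.pi_pos
  have h := summable_pow_mul_jacobiTheta₂_term_bound 0 (T := 1 / (Real.pi * c)) (by positivity) 0
  refine h.congr fun n => ?_
  simp only [pow_zero, one_mul, mul_zero, zero_mul, sub_zero]
  congr 1
  field_simp

/-- For irrational `α` and `t > 0`, the sum over nonzero lattice points
`Σ_{(k,l) ≠ (0,0)} exp(−(k+αl)²/(4t(1+α²)) − (l−αk)²/(4th²(1+α²)))` tends to `0`
as `h → 0⁺`. -/
theorem offdiagonal_heat_sum_tendsto_zero (α : ℝ) (hα : Irrational α)
    (t : ℝ) (ht : 0 < t) :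
    Tendsto (fun h : ℝ =>
        ∑' kl : {x : ℤ × ℤ // x ≠ (0, 0)},
          Real.exp (-(((kl : ℤ × ℤ).1 : ℝ) + α * ((kl : ℤ × ℤ).2 : ℝ)) ^ 2 /
              (4 * t * (1 + α ^ 2))
            - (((kl : ℤ × ℤ).2 : ℝ) - α * ((kl : ℤ × ℤ).1 : ℝ)) ^ 2 /
              (4 * t * h ^ 2 * (1 + α ^ 2))))
      (nhdsWithin 0 (Set.Ioi 0)) (nhds 0) := by
  have hs := aux_summable (4 * t) (by positivity)
  have hs2 := hs.mul_of_nonneg hs (fun _ => (Real.exp_pos _).le) (fun _ => (Real.exp_pos _).le)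
  have hs3 := hs2.comp_injective (i := fun x : {x : ℤ × ℤ // x ≠ (0, 0)} => (x : ℤ × ℤ))
    Subtype.val_injective
  have key := tendsto_tsum_of_dominated_convergence
    (𝓕 := nhdsWithin (0 : ℝ) (Set.Ioi 0))
    (f := fun (h : ℝ) (kl : {x : ℤ × ℤ // x ≠ (0, 0)}) =>
          Real.exp (-(((kl : ℤ × ℤ).1 : ℝ) + α * ((kl : ℤ × ℤ).2 : ℝ)) ^ 2 /
              (4 * t * (1 + α ^ 2))
            - (((kl : ℤ × ℤ).2 : ℝ) - α * ((kl : ℤ × ℤ).1 : ℝ)) ^ 2 /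
              (4 * t * h ^ 2 * (1 + α ^ 2))))
    (g := fun _ => 0) hs3 ?_ ?_
  · simpa using key
  · rintro ⟨⟨k, l⟩, hkl⟩
    have hne : (l : ℝ) - α * k ≠ 0 := by
      intro h0
      by_cases hk : k = 0
      · subst hk
        have : l = 0 := by simpa using h0
        subst this
        exact hkl rfl
      · apply hα
        have hk' : (k : ℝ) ≠ 0 := by exact_mod_cast hk
        refine ⟨(l : ℚ) / k, ?_⟩
        push_cast
        field_simp
        linarith
    apply Real.tendsto_exp_atBot.comp
    simp only [sub_eq_add_neg]
    apply tendsto_atBot_add_const_left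
    apply tendsto_neg_atTop_atBot.comp
    have hD : 0 < ((l : ℝ) - α * k) ^ 2 / (4 * t * (1 + α ^ 2)) := by positivity
    have h1 : Tendsto (fun h : ℝ => (h⁻¹) ^ 2) (nhdsWithin 0 (Set.Ioi 0)) atTop :=
      (tendsto_pow_atTop two_ne_zero).comp tendsto_inv_nhdsGT_zero
    refine (h1.const_mul_atTop hD).congr fun h => ?_
    simp only [div_eq_mul_inv, mul_inv, inv_pow, sub_eq_add_neg]
    ring
  · have hev : ∀ᶠ h : ℝ in nhdsWithin 0 (Set.Ioi 0), h ∈ Set.Ioc (0 : ℝ) 1 :=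
      Ioc_mem_nhdsGT one_pos
    filter_upwards [hev] with h hh
    rintro ⟨⟨k, l⟩, hkl⟩
    obtain ⟨h0, h1⟩ := hh
    simp only [Function.comp, Real.norm_eq_abs, Real.abs_exp, ← Real.exp_add]
    apply Real.exp_le_exp.mpr
    have hle : ((l : ℝ) - α * k) ^ 2 / (4 * t * (1 + α ^ 2)) ≤
        ((l : ℝ) - α * k) ^ 2 / (4 * t * h ^ 2 * (1 + α ^ 2)) := by
      have : h ^ 2 ≤ 1 := pow_le_one₀ h0.le h1
      apply div_le_div_of_nonneg_left (by positivity) (by positivity)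
      have h4 : 4 * t * h ^ 2 ≤ 4 * t := by nlinarith
      exact mul_le_mul_of_nonneg_right h4 (by positivity)
    have hid : -((k : ℝ) + α * l) ^ 2 / (4 * t * (1 + α ^ 2))
        - ((l : ℝ) - α * k) ^ 2 / (4 * t * (1 + α ^ 2))
        = -((k : ℝ) ^ 2 / (4 * t)) + -((l : ℝ) ^ 2 / (4 * t)) := by
      have : (1 + α ^ 2) ≠ 0 := by positivity
      field_simp
      ring
    linarith
end

section
/- Let α be an irrational real number and t > 0. Then lim_{h→0⁺} h · Σ_{(k,l) ∈ ℤ²} exp(−(4π²t/(1+α²))·((k+αl)² + h²·(l−αk)²)) = 1/(4πt). -/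
open Filter

lemma aux_summable_gauss {a : ℝ} (ha : 0 < a) :
    Summable fun n : ℤ => Real.exp (-a * (n : ℝ) ^ 2) := by
  have h := ((summable_jacobiTheta₂_term_iff 0 (Complex.I * ((a / Real.pi : ℝ) : ℂ))).2
    (by simp; positivity)).norm
  refine h.congr fun n => ?_
  rw [norm_jacobiTheta₂_term]
  congr 1
  simp
  field_simp

lemma aux_summable_gauss2 {a b : ℝ} (ha : 0 < a) (hb : 0 < b) :
    Summable fun p : ℤ × ℤ => Real.exp (-a * (p.1 : ℝ) ^ 2 - b * (p.2 : ℝ) ^ 2) := by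
  refine ((aux_summable_gauss ha).mul_of_nonneg (aux_summable_gauss hb)
    (fun _ => (Real.exp_pos _).le) (fun _ => (Real.exp_pos _).le)).congr fun p => ?_
  rw [← Real.exp_add]
  congr 1
  ring

lemma aux_poisson (A B C s : ℝ) (hC : 0 < C) (hs : 0 < s) (hD : A * C - B ^ 2 = s ^ 2)
    (hsum : Summable fun p : ℤ × ℤ =>
      Real.exp (-Real.pi * (A * (p.1 : ℝ) ^ 2 + 2 * B * p.1 * p.2 + C * (p.2 : ℝ) ^ 2)))
    (hsum' : Summable fun p : ℤ × ℤ =>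
      Real.exp (-Real.pi / s ^ 2 *
        (A * (p.1 : ℝ) ^ 2 - 2 * B * p.1 * p.2 + C * (p.2 : ℝ) ^ 2))) :
    ∑' p : ℤ × ℤ,
      Real.exp (-Real.pi * (A * (p.1 : ℝ) ^ 2 + 2 * B * p.1 * p.2 + C * (p.2 : ℝ) ^ 2))
    = 1 / s * ∑' p : ℤ × ℤ, Real.exp (-Real.pi / s ^ 2 *
        (A * (p.1 : ℝ) ^ 2 - 2 * B * p.1 * p.2 + C * (p.2 : ℝ) ^ 2)) := by
  have hpi := Real.pi_pos
  have hCc : (C : ℂ) ≠ 0 := by exact_mod_cast hC.ne'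
  have hsc : (s : ℂ) ≠ 0 := by exact_mod_cast hs.ne'
  have hDc : (A : ℂ) * C - B ^ 2 = s ^ 2 := by exact_mod_cast hD
  have hA : (A : ℂ) = (s ^ 2 + B ^ 2) / C := by
    field_simp
    linear_combination hDc
  let F : ℤ → ℤ → ℂ := fun k m => Complex.exp
    (-Real.pi / C * ((m : ℂ) + Complex.I * (-B * k)) ^ 2 - Real.pi * A * k ^ 2)
  have hF : Summable (Function.uncurry F) := by
    apply Summable.of_norm
    refine (aux_summable_gauss2 (a := Real.pi * s ^ 2 / C) (b := Real.pi / C)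
      (by positivity) (by positivity)).congr fun p => ?_
    have : Function.uncurry F p = Complex.exp
      (((-(Real.pi * s ^ 2 / C) * (p.1 : ℝ) ^ 2 - Real.pi / C * (p.2 : ℝ) ^ 2 : ℝ) : ℂ)
        + ((2 * Real.pi / C * B * p.1 * p.2 : ℝ) : ℂ) * Complex.I) := by
      simp only [Function.uncurry, F]
      congr 1
      push_cast
      rw [hA]
      field_simp
      ring_nf
      rw [Complex.I_sq]
      ring
    rw [this, Complex.norm_exp, Complex.add_re, Complex.ofReal_re, Complex.re_ofReal_mul,
      Complex.I_re, mul_zero, add_zero]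
  have step1 : ∀ k : ℤ, ∑' l : ℤ, Complex.exp
      (-Real.pi * (A * (k : ℂ) ^ 2 + 2 * B * k * l + C * (l : ℂ) ^ 2))
      = 1 / (C : ℂ) ^ (1 / 2 : ℂ) * ∑' m : ℤ, F k m := by
    intro k
    have h := Complex.tsum_exp_neg_quadratic (a := (C : ℂ)) (by simpa using hC) (-B * k)
    have e1 : ∀ l : ℤ, Complex.exp
      (-Real.pi * (A * (k : ℂ) ^ 2 + 2 * B * k * l + C * (l : ℂ) ^ 2)) =
      Complex.exp (-(Real.pi * A * k ^ 2)) *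
       Complex.exp (-Real.pi * C * l ^ 2 + 2 * Real.pi * (-B * k) * l) := by
      intro l
      rw [← Complex.exp_add]; congr 1; ring
    have e2 : ∀ m : ℤ, F k m = Complex.exp (-(Real.pi * A * k ^ 2)) *
        Complex.exp (-Real.pi / C * ((m : ℂ) + Complex.I * (-B * k)) ^ 2) := by
      intro m
      simp only [F]
      rw [← Complex.exp_add]; congr 1; ring
    simp_rw [e1, e2]
    rw [tsum_mul_left, tsum_mul_left, h]
    ring
  have step2 : ∀ m : ℤ, ∑' k : ℤ, F k m = 1 / ((s ^ 2 / C : ℝ) : ℂ) ^ (1 / 2 : ℂ) *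
      ∑' n : ℤ, Complex.exp (-Real.pi / s ^ 2 *
        (A * (m : ℂ) ^ 2 - 2 * B * m * n + C * (n : ℂ) ^ 2)) := by
    intro m
    have h := Complex.tsum_exp_neg_quadratic (a := ((s ^ 2 / C : ℝ) : ℂ))
      (by rw [Complex.ofReal_re]; positivity) (Complex.I * (B * m / C))
    have e1 : ∀ k : ℤ, F k m = Complex.exp (-(Real.pi / C * m ^ 2)) *
       Complex.exp (-Real.pi * ((s ^ 2 / C : ℝ) : ℂ) * k ^ 2 +
        2 * Real.pi * (Complex.I * (B * m / C)) * k) := by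
      intro k
      simp only [F]
      rw [← Complex.exp_add]; congr 1
      push_cast
      rw [hA]
      field_simp
      ring_nf
      rw [Complex.I_sq]
      ring
    have e2 : ∀ n : ℤ, Complex.exp (-Real.pi / s ^ 2 *
        (A * (m : ℂ) ^ 2 - 2 * B * m * n + C * (n : ℂ) ^ 2)) =
        Complex.exp (-(Real.pi / C * m ^ 2)) *
        Complex.exp (-Real.pi / ((s ^ 2 / C : ℝ) : ℂ) *
          ((n : ℂ) + Complex.I * (Complex.I * (B * m / C))) ^ 2) := by
      intro n
      rw [← Complex.exp_add]; congr 1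
      rw [← mul_assoc Complex.I, Complex.I_mul_I]
      push_cast
      rw [hA]
      field_simp
      ring
    simp_rw [e1, e2]
    rw [tsum_mul_left, tsum_mul_left, h]
    ring
  have hconst : 1 / (C : ℂ) ^ (1 / 2 : ℂ) * (1 / ((s ^ 2 / C : ℝ) : ℂ) ^ (1 / 2 : ℂ))
      = 1 / (s : ℂ) := by
    have h1 : (1 / 2 : ℂ) = ((1 / 2 : ℝ) : ℂ) := by push_cast; rfl
    rw [h1, ← Complex.ofReal_cpow hC.le, ← Complex.ofReal_cpow (by positivity)]
    rw [← Real.sqrt_eq_rpow, ← Real.sqrt_eq_rpow, Real.sqrt_div (by positivity),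
      Real.sqrt_sq hs.le]
    have h2 : ((Real.sqrt C : ℝ) : ℂ) ≠ 0 := by
      exact_mod_cast (Real.sqrt_pos.2 hC).ne'
    push_cast
    field_simp
  have hc1 := Complex.ofRealCLM.summable hsum
  have hc2 := Complex.ofRealCLM.summable hsum'
  simp only [Complex.ofRealCLM_apply] at hc1 hc2
  rw [← Complex.ofReal_inj, Complex.ofReal_mul, Complex.ofReal_tsum, Complex.ofReal_tsum,
    hc1.tsum_prod, hc2.tsum_prod]
  push_cast
  simp_rw [step1]
  rw [tsum_mul_left, ← hF.tsum_comm]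
  simp_rw [step2]
  rw [tsum_mul_left, ← mul_assoc, hconst]

/-- For irrational `α` and `t > 0`, the rescaled heat trace
`h · Σ_{(k,l) ∈ ℤ²} exp(−(4π²t/(1+α²))((k+αl)² + h²(l−αk)²))` tends to
`1/(4πt)` as `h → 0⁺`. -/
theorem heat_trace_adiabatic_limit (α : ℝ) (hα : Irrational α) (t : ℝ) (ht : 0 < t) :
    Tendsto (fun h : ℝ =>
        h * ∑' kl : ℤ × ℤ,
          Real.exp (-(4 * Real.pi ^ 2 * t / (1 + α ^ 2)) *
            (((kl.1 : ℝ) + α * (kl.2 : ℝ)) ^ 2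
              + h ^ 2 * ((kl.2 : ℝ) - α * (kl.1 : ℝ)) ^ 2)))
      (nhdsWithin 0 (Set.Ioi 0)) (nhds (1 / (4 * Real.pi * t))) := by
  have hpi := Real.pi_pos
  have hα2 : 0 < 1 + α ^ 2 := by positivity
  have hα0 : α ≠ 0 := hα.ne_zero
  have hmem : ∀ᶠ h : ℝ in nhdsWithin 0 (Set.Ioi 0), h ∈ Set.Ioo (0 : ℝ) 1 :=
    Ioo_mem_nhdsGT one_pos
  -- the dual term
  let G : ℝ → ℤ × ℤ → ℝ := fun h p => Real.exp (-(1 / (4 * t * (1 + α ^ 2))) *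
    (((p.2 : ℝ) * α - p.1) ^ 2 * (h ^ 2)⁻¹ + ((p.1 : ℝ) * α + p.2) ^ 2))
  let bd : ℤ × ℤ → ℝ := fun p => Real.exp (-(1 / (4 * t)) * (p.1 : ℝ) ^ 2
    - (1 / (4 * t)) * (p.2 : ℝ) ^ 2)
  have hbd : Summable bd := aux_summable_gauss2 (by positivity) (by positivity)
  have hGbd : ∀ h ∈ Set.Ioo (0 : ℝ) 1, ∀ p, G h p ≤ bd p := by
    intro h hh p
    apply Real.exp_le_exp.2
    have h1 : 1 ≤ (h ^ 2)⁻¹ := by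
      apply (one_le_inv₀ (pow_pos hh.1 2)).2
      exact pow_le_one₀ hh.1.le hh.2.le
    have e : -(1 / (4 * t)) * (p.1 : ℝ) ^ 2 - (1 / (4 * t)) * (p.2 : ℝ) ^ 2 =
      -(1 / (4 * t * (1 + α ^ 2))) *
        (((p.2 : ℝ) * α - p.1) ^ 2 * 1 + ((p.1 : ℝ) * α + p.2) ^ 2) := by
      field_simp
      ring
    rw [e, neg_mul, neg_mul]
    gcongr
  have hGs : ∀ h ∈ Set.Ioo (0 : ℝ) 1, Summable (G h) := fun h hh =>
    hbd.of_nonneg_of_le (fun _ => (Real.exp_pos _).le) (hGbd h hh)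
  have key : ∀ h ∈ Set.Ioo (0 : ℝ) 1, h * ∑' kl : ℤ × ℤ,
          Real.exp (-(4 * Real.pi ^ 2 * t / (1 + α ^ 2)) *
            (((kl.1 : ℝ) + α * (kl.2 : ℝ)) ^ 2
              + h ^ 2 * ((kl.2 : ℝ) - α * (kl.1 : ℝ)) ^ 2))
      = 1 / (4 * Real.pi * t) * ∑' p, G h p := by
    intro h hh
    have hh0 : 0 < h := hh.1
    set A : ℝ := 4 * Real.pi * t / (1 + α ^ 2) * (1 + h ^ 2 * α ^ 2) with hA
    set B : ℝ := 4 * Real.pi * t / (1 + α ^ 2) * (α * (1 - h ^ 2)) with hB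
    set C : ℝ := 4 * Real.pi * t / (1 + α ^ 2) * (α ^ 2 + h ^ 2) with hC
    have e1 : ∀ p : ℤ × ℤ, Real.exp (-(4 * Real.pi ^ 2 * t / (1 + α ^ 2)) *
            (((p.1 : ℝ) + α * (p.2 : ℝ)) ^ 2
              + h ^ 2 * ((p.2 : ℝ) - α * (p.1 : ℝ)) ^ 2)) =
        Real.exp (-Real.pi * (A * (p.1 : ℝ) ^ 2 + 2 * B * p.1 * p.2 + C * (p.2 : ℝ) ^ 2)) := by
      intro p
      congr 1
      rw [hA, hB, hC]
      field_simp
      ring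
    have e2 : ∀ p : ℤ × ℤ, G h p = Real.exp (-Real.pi / (4 * Real.pi * t * h) ^ 2 *
        (A * (p.1 : ℝ) ^ 2 - 2 * B * p.1 * p.2 + C * (p.2 : ℝ) ^ 2)) := by
      intro p
      simp only [G]
      congr 1
      rw [hA, hB, hC]
      field_simp
      ring
    have hs2 := (hGs h hh).congr (fun p => e2 p)
    have hs1 : Summable fun p : ℤ × ℤ => Real.exp (-(4 * Real.pi ^ 2 * t / (1 + α ^ 2)) *
            (((p.1 : ℝ) + α * (p.2 : ℝ)) ^ 2
              + h ^ 2 * ((p.2 : ℝ) - α * (p.1 : ℝ)) ^ 2)) := by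
      refine (aux_summable_gauss2 (a := 4 * Real.pi ^ 2 * t * h ^ 2)
        (b := 4 * Real.pi ^ 2 * t * h ^ 2) (by positivity) (by positivity)).of_nonneg_of_le
        (fun _ => (Real.exp_pos _).le) fun p => ?_
      apply Real.exp_le_exp.2
      have e : -(4 * Real.pi ^ 2 * t * h ^ 2) * (p.1 : ℝ) ^ 2
          - (4 * Real.pi ^ 2 * t * h ^ 2) * (p.2 : ℝ) ^ 2 =
          -(4 * Real.pi ^ 2 * t / (1 + α ^ 2)) *
            (h ^ 2 * ((p.1 : ℝ) + α * (p.2 : ℝ)) ^ 2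
              + h ^ 2 * ((p.2 : ℝ) - α * (p.1 : ℝ)) ^ 2) := by
        field_simp
        ring
      rw [e, neg_mul, neg_mul]
      gcongr
      exact mul_le_of_le_one_left (sq_nonneg _) (pow_le_one₀ hh.1.le hh.2.le)
    have hs1' := hs1.congr (fun p => e1 p)
    simp_rw [e1, e2]
    rw [aux_poisson A B C (4 * Real.pi * t * h) (by positivity) (by positivity)
      (by rw [hA, hB, hC]; field_simp; ring) hs1' hs2, ← mul_assoc]
    congr 1
    field_simp
  have hlim : Tendsto (fun h => ∑' p, G h p) (nhdsWithin 0 (Set.Ioi 0))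
      (nhds (∑' p : ℤ × ℤ, if p = 0 then (1 : ℝ) else 0)) := by
    refine tendsto_tsum_of_dominated_convergence hbd ?_ ?_
    · intro p
      split_ifs with hp
      · subst hp
        simp [G]
      · have hne : (p.2 : ℝ) * α - p.1 ≠ 0 := by
          intro h0
          rcases eq_or_ne p.2 0 with h2 | h2
          · apply hp
            simp [h2] at h0
            exact Prod.ext h0 h2
          · exact (hα.intCast_mul h2).ne_int p.1 (sub_eq_zero.1 h0)
        have hi : Tendsto (fun h : ℝ => (h ^ 2)⁻¹) (nhdsWithin 0 (Set.Ioi 0)) atTop := by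
          have := tendsto_inv_nhdsGT_zero (𝕜 := ℝ)
          refine ((tendsto_pow_atTop two_ne_zero).comp this).congr fun h => ?_
          simp
        apply Real.tendsto_exp_atBot.comp
        apply Tendsto.const_mul_atTop_of_neg
        · rw [neg_lt_zero]; positivity
        · exact tendsto_atTop_add_const_right _ _ (hi.const_mul_atTop (by positivity))
    · filter_upwards [hmem] with h hh p
      rw [Real.norm_of_nonneg (Real.exp_pos _).le]
      exact hGbd h hh p
  rw [tsum_ite_eq] at hlim
  have := hlim.const_mul (1 / (4 * Real.pi * t))
  rw [mul_one] at this
  refine this.congr' ?_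
  filter_upwards [hmem] with h hh
  exact (key h hh).symm
end

section
/- Let α ∈ ℝ and h > 0. The function H: (0,∞) × ℝ² → ℝ defined by H(t,x,y) = (h⁻¹/(4πt))·exp(−((x+αy)² + h⁻²·(y−αx)²)/(4t(1+α²))) satisfies the heat equation ∂H/∂t = (1/(1+α²))·(∂/∂x + α·∂/∂y)² H + (h²/(1+α²))·(−α·∂/∂x + ∂/∂y)² H for all t > 0 and (x,y) ∈ ℝ². -/
/-- Directional derivative of a real-valued function on `ℝ²` in the direction `w`. -/
noncomputable def dirDerivR (w : ℝ × ℝ) (f : ℝ × ℝ → ℝ) : ℝ × ℝ → ℝ :=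
  fun p => fderiv ℝ f p w

/-- The heat kernel `H(t,x,y) = (h⁻¹/(4πt)) exp(−((x+αy)² + h⁻²(y−αx)²)/(4t(1+α²)))`. -/
noncomputable def heatKernel (α h : ℝ) : ℝ → ℝ × ℝ → ℝ :=
  fun t p => (h⁻¹ / (4 * Real.pi * t)) *
    Real.exp (-(((p.1 + α * p.2) ^ 2 + (h ^ 2)⁻¹ * (p.2 - α * p.1) ^ 2) /
      (4 * t * (1 + α ^ 2))))

theorem dirDerivR_of_line (w p : ℝ × ℝ) (f : ℝ × ℝ → ℝ) (d : ℝ)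
    (hf : DifferentiableAt ℝ f p)
    (hd : HasDerivAt (fun s : ℝ => f (p.1 + s * w.1, p.2 + s * w.2)) d 0) :
    dirDerivR w f p = d := by
  have h1 := hf.lineDeriv_eq_fderiv (v := w)
  unfold dirDerivR
  rw [← h1]
  exact hd.deriv

theorem heatKernel_differentiable (α h t : ℝ) : Differentiable ℝ (heatKernel α h t) := by
  unfold heatKernel
  fun_prop

theorem heatKernel_line (α h t : ℝ) (w p : ℝ × ℝ) :
    HasDerivAt (fun s : ℝ => heatKernel α h t (p.1 + s * w.1, p.2 + s * w.2))
      (-((2 * (p.1 + α * p.2) * (w.1 + α * w.2)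
        + (h ^ 2)⁻¹ * (2 * (p.2 - α * p.1) * (w.2 - α * w.1))) / (4 * t * (1 + α ^ 2)))
        * heatKernel α h t p) 0 := by
  have hx : HasDerivAt (fun s : ℝ => p.1 + s * w.1) w.1 0 := by
    simpa using ((hasDerivAt_id (0:ℝ)).mul_const w.1).const_add p.1
  have hy : HasDerivAt (fun s : ℝ => p.2 + s * w.2) w.2 0 := by
    simpa using ((hasDerivAt_id (0:ℝ)).mul_const w.2).const_add p.2
  have := ((((((hx.fun_add (hy.const_mul α)).fun_pow 2).fun_add
    (((hy.fun_sub (hx.const_mul α)).fun_pow 2).const_mul (h ^ 2)⁻¹)).div_const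
      (4 * t * (1 + α ^ 2))).fun_neg).exp).const_mul (h⁻¹ / (4 * Real.pi * t))
  unfold heatKernel
  refine this.congr_deriv ?_
  simp
  ring

theorem dirDerivR_heatKernel (α h t : ℝ) (w : ℝ × ℝ) :
    dirDerivR w (heatKernel α h t) = fun p =>
      -((2 * (p.1 + α * p.2) * (w.1 + α * w.2)
        + (h ^ 2)⁻¹ * (2 * (p.2 - α * p.1) * (w.2 - α * w.1))) / (4 * t * (1 + α ^ 2)))
        * heatKernel α h t p := by
  funext p
  exact dirDerivR_of_line w p _ _ (heatKernel_differentiable α h t p) (heatKernel_line α h t w p)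

theorem dirDerivR_dirDerivR_heatKernel (α h t : ℝ) (w p : ℝ × ℝ) :
    dirDerivR w (dirDerivR w (heatKernel α h t)) p =
      (-((2 * (w.1 + α * w.2) ^ 2
        + (h ^ 2)⁻¹ * (2 * (w.2 - α * w.1) ^ 2)) / (4 * t * (1 + α ^ 2)))
      + ((2 * (p.1 + α * p.2) * (w.1 + α * w.2)
        + (h ^ 2)⁻¹ * (2 * (p.2 - α * p.1) * (w.2 - α * w.1))) / (4 * t * (1 + α ^ 2))) ^ 2)
        * heatKernel α h t p := by
  rw [dirDerivR_heatKernel]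
  have hk := heatKernel_differentiable α h t
  refine dirDerivR_of_line w p _ _ ?_ ?_
  · fun_prop
  have hx : HasDerivAt (fun s : ℝ => p.1 + s * w.1) w.1 0 := by
    simpa using ((hasDerivAt_id (0:ℝ)).mul_const w.1).const_add p.1
  have hy : HasDerivAt (fun s : ℝ => p.2 + s * w.2) w.2 0 := by
    simpa using ((hasDerivAt_id (0:ℝ)).mul_const w.2).const_add p.2
  have := (((((hx.fun_add (hy.const_mul α)).const_mul 2).mul_const (w.1 + α * w.2)).fun_add
    ((((hy.fun_sub (hx.const_mul α)).const_mul 2).mul_const (w.2 - α * w.1)).const_mul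
      (h ^ 2)⁻¹)).div_const (4 * t * (1 + α ^ 2))).fun_neg.fun_mul (heatKernel_line α h t w p)
  refine this.congr_deriv ?_
  simp
  ring

/-- The function `H(t,x,y) = (h⁻¹/(4πt)) exp(−((x+αy)² + h⁻²(y−αx)²)/(4t(1+α²)))`
satisfies the heat equation
`∂H/∂t = (1/(1+α²))(∂_x + α∂_y)²H + (h²/(1+α²))(−α∂_x + ∂_y)²H` for `t > 0`. -/
theorem heatKernel_heat_equation (α h : ℝ) (hh : 0 < h) :
    ∀ t : ℝ, 0 < t → ∀ p : ℝ × ℝ,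
      deriv (fun s : ℝ => heatKernel α h s p) t
        = (1 / (1 + α ^ 2)) *
            dirDerivR (1, α) (dirDerivR (1, α) (heatKernel α h t)) p
          + (h ^ 2 / (1 + α ^ 2)) *
            dirDerivR (-α, 1) (dirDerivR (-α, 1) (heatKernel α h t)) p := by
  intro t ht p
  rw [dirDerivR_dirDerivR_heatKernel, dirDerivR_dirDerivR_heatKernel]
  have hk : (1 + α ^ 2) ≠ 0 := by positivity
  have hd : HasDerivAt (fun s : ℝ => heatKernel α h s p)
      ((-1 / t + ((p.1 + α * p.2) ^ 2 + (h ^ 2)⁻¹ * (p.2 - α * p.1) ^ 2) /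
        (4 * t ^ 2 * (1 + α ^ 2))) * heatKernel α h t p) t := by
    have h1 : HasDerivAt (fun s : ℝ => h⁻¹ / (4 * Real.pi * s)) _ t :=
      (hasDerivAt_const t h⁻¹).fun_div ((hasDerivAt_id' t).const_mul (4 * Real.pi))
        (by positivity)
    have h2 := ((hasDerivAt_const t
      ((p.1 + α * p.2) ^ 2 + (h ^ 2)⁻¹ * (p.2 - α * p.1) ^ 2)).fun_div
        (((hasDerivAt_id' t).const_mul 4).mul_const (1 + α ^ 2)) (by positivity)).fun_neg.exp
    unfold heatKernel
    refine (h1.fun_mul h2).congr_deriv ?_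
    generalize Real.exp _ = E
    field_simp
    ring
  rw [hd.deriv]
  generalize heatKernel α h t p = E
  simp only
  field_simp
  ring
end
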